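/- arXiv:1412.4569 — 5 statements merged into one kernel-verified Lean document; each statement's English description precedes it below -/
import Mathlib

section
/- For every natural number n, the Bessel function of the first kind of order n satisfies Bessel's equation of order n: for all real x, x² · J_n''(x) + x · J_n'(x) + (x² − n²) · J_n(x) = 0. -/
/-- The Bessel function of the first kind of order `n`, defined by its power series. -/
noncomputable def besselJ (n : ℕ) (x : ℝ) : ℝ :=
  ∑' q : ℕ, (-1 : ℝ) ^ q / (Nat.factorial q * Nat.factorial (q + n)) * (x / 2) ^ (2 * q + n)

/-- Absolute convergence of the series `∑ a q * R ^ e q` for all large `R`. -/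
def BesselAux.Good (a : ℕ → ℝ) (e : ℕ → ℕ) : Prop :=
  ∀ R : ℝ, 1 ≤ R → Summable fun q => |a q| * R ^ e q

lemma BesselAux.Good.deriv {a : ℕ → ℝ} {e : ℕ → ℕ} (h : BesselAux.Good a e) :
    BesselAux.Good (fun q => a q * e q) (fun q => e q - 1) := by
  intro R hR
  refine Summable.of_nonneg_of_le (fun q => by positivity) (fun q => ?_) (h (2 * R) (by linarith))
  rw [abs_mul, Nat.abs_cast, mul_assoc, mul_pow]
  have h1 : (e q : ℝ) ≤ 2 ^ e q := by exact_mod_cast Nat.lt_two_pow_self.le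
  have h2 : R ^ (e q - 1) ≤ R ^ e q := pow_le_pow_right₀ hR (Nat.sub_le _ _)
  gcongr

lemma BesselAux.Good.summable {a : ℕ → ℝ} {e : ℕ → ℕ} (h : BesselAux.Good a e) (x : ℝ) :
    Summable fun q => a q * x ^ e q := by
  refine Summable.of_norm_bounded (h (|x| + 1) (by linarith [abs_nonneg x])) (fun q => ?_)
  rw [Real.norm_eq_abs, abs_mul, abs_pow]
  gcongr
  linarith

lemma BesselAux.Good.hasDerivAt {a : ℕ → ℝ} {e : ℕ → ℕ} (h : BesselAux.Good a e) (x : ℝ) :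
    HasDerivAt (fun y => ∑' q, a q * y ^ e q) (∑' q, a q * e q * x ^ (e q - 1)) x := by
  have hx : x ∈ Metric.ball (0 : ℝ) (|x| + 1) := by simp
  refine hasDerivAt_tsum_of_isPreconnected (g := fun q y => a q * y ^ e q)
    (g' := fun q y => a q * e q * y ^ (e q - 1))
    (h.deriv (|x| + 1) (by linarith [abs_nonneg x]))
    Metric.isOpen_ball (convex_ball _ _).isPreconnected (fun q y _ => ?_) (fun q y hy => ?_) hx
    (h.summable x) hx
  · have := (hasDerivAt_pow (e q) y).const_mul (a q)
    rwa [← mul_assoc] at this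
  · rw [Real.norm_eq_abs, abs_mul, abs_pow]
    have : |y| ≤ |x| + 1 := by simpa using (Metric.mem_ball.1 hy).le
    gcongr

/-- The Taylor coefficients of the Bessel function. -/
noncomputable def BesselAux.coef (n q : ℕ) : ℝ :=
  (-1 : ℝ) ^ q / (Nat.factorial q * Nat.factorial (q + n)) / 2 ^ (2 * q + n)

lemma BesselAux.good_coef (n : ℕ) : BesselAux.Good (BesselAux.coef n) (fun q => 2 * q + n) := by
  intro R hR
  refine Summable.of_nonneg_of_le (fun q => by positivity) (fun q => ?_)
    ((Real.summable_pow_div_factorial (R ^ 2)).mul_right (R ^ n))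
  have h1 : |BesselAux.coef n q| ≤ 1 / (Nat.factorial q : ℝ) := by
    unfold BesselAux.coef
    rw [abs_div, abs_div, abs_pow, abs_neg, abs_one, one_pow, div_div,
      abs_of_pos (by positivity), abs_of_pos (by positivity)]
    have h2 : (1 : ℝ) ≤ Nat.factorial (q + n) := by exact_mod_cast Nat.factorial_pos _
    have h3 : (1 : ℝ) ≤ 2 ^ (2 * q + n) := one_le_pow₀ (by norm_num)
    apply one_div_le_one_div_of_le (by positivity)
    rw [mul_assoc]
    exact le_mul_of_one_le_right (by positivity) (one_le_mul_of_one_le_of_one_le h2 h3)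
  calc |BesselAux.coef n q| * R ^ (2 * q + n)
      ≤ 1 / (Nat.factorial q : ℝ) * R ^ (2 * q + n) := by gcongr
    _ = _ := by rw [pow_add, pow_mul]; ring

lemma BesselAux.coef_succ (n q : ℕ) :
    BesselAux.coef n (q + 1) * (4 * (q + 1) * (q + 1 + n)) = - BesselAux.coef n q := by
  unfold BesselAux.coef
  rw [show q + 1 + n = (q + n) + 1 by ring, show 2 * (q + 1) + n = (2 * q + n) + 2 by ring,
    Nat.factorial_succ, Nat.factorial_succ, pow_succ, pow_add]
  push_cast
  have h1 : (q : ℝ) + 1 ≠ 0 := by positivity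
  have h2 : (q : ℝ) + n + 1 ≠ 0 := by positivity
  have h3 := Nat.factorial_ne_zero q
  have h4 := Nat.factorial_ne_zero (q + n)
  field_simp
  ring

lemma BesselAux.besselJ_eq (n : ℕ) :
    besselJ n = fun x => ∑' q, BesselAux.coef n q * x ^ (2 * q + n) := by
  funext x
  unfold besselJ BesselAux.coef
  refine tsum_congr fun q => ?_
  rw [div_pow]
  ring

/-- The Bessel function of the first kind of order `n` satisfies Bessel's equation of order `n`:
`x² Jₙ''(x) + x Jₙ'(x) + (x² − n²) Jₙ(x) = 0` for all real `x`. -/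
theorem besselJ_satisfies_bessel_equation (n : ℕ) (x : ℝ) :
    x ^ 2 * deriv (deriv (besselJ n)) x + x * deriv (besselJ n) x
      + (x ^ 2 - (n : ℝ) ^ 2) * besselJ n x = 0 := by
  have g0 := BesselAux.good_coef n
  have g1 := g0.deriv
  have g2 := g1.deriv
  have d1 := funext fun y => (g0.hasDerivAt y).deriv
  have d2 := (g1.hasDerivAt x).deriv
  rw [BesselAux.besselJ_eq, d1, d2]
  have s0 := g0.summable x
  have s1 := (g1.summable x).mul_left x
  have s2 := (g2.summable x).mul_left (x ^ 2)
  have s3 := s0.mul_left ((n : ℝ) ^ 2)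
  have key : ∀ q : ℕ, x ^ 2 * (BesselAux.coef n q * ((2 * q + n : ℕ) : ℝ) *
        ((2 * q + n - 1 : ℕ) : ℝ) * x ^ (2 * q + n - 1 - 1))
      + x * (BesselAux.coef n q * ((2 * q + n : ℕ) : ℝ) * x ^ (2 * q + n - 1))
      - (n : ℝ) ^ 2 * (BesselAux.coef n q * x ^ (2 * q + n))
      = BesselAux.coef n q * (4 * q * (q + n)) * x ^ (2 * q + n) := by
    intro q
    have h : ((2 * q + n : ℕ) : ℝ) ^ 2 - (n : ℝ) ^ 2 = 4 * q * (q + n) := by push_cast; ring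
    rw [← h]
    generalize 2 * q + n = m
    rcases m with _ | _ | m
    · simp; ring
    · simp; ring
    · simp only [Nat.add_sub_cancel]
      push_cast
      ring
  have s4 := (s2.add s1).sub s3
  have e4 := ((s2.add s1).tsum_sub s3)
  rw [s2.tsum_add s1, tsum_mul_left, tsum_mul_left, tsum_mul_left] at e4
  rw [tsum_congr key] at e4
  rw [(summable_congr key)] at s4
  rw [s4.tsum_eq_zero_add] at e4
  have e5 : ∑' q : ℕ, BesselAux.coef n (q + 1) * (4 * ((q + 1 : ℕ) : ℝ) * (((q + 1 : ℕ) : ℝ) + n))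
        * x ^ (2 * (q + 1) + n)
      = - (x ^ 2 * ∑' q : ℕ, BesselAux.coef n q * x ^ (2 * q + n)) := by
    rw [← tsum_mul_left, ← tsum_neg]
    refine tsum_congr fun q => ?_
    push_cast
    rw [BesselAux.coef_succ]
    ring
  rw [e5] at e4
  simp only [Nat.cast_zero, mul_zero, zero_mul, zero_add] at e4
  beta_reduce
  linarith
end

section
/- Let n be a natural number and k a real number, and define h(r) := J_n(k·r). Then h satisfies the parametric Bessel equation: for all real r, r² · h''(r) + r · h'(r) + (k²·r² − n²) · h(r) = 0. -/
noncomputable def gterm (n : ℕ) (q : ℕ) (y : ℝ) : ℝ :=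
  (-1 : ℝ) ^ q / (Nat.factorial q * Nat.factorial (q + n)) * y ^ q

noncomputable def gfun (n : ℕ) (y : ℝ) : ℝ := ∑' q : ℕ, gterm n q y

lemma gterm_coeff_bound (n q : ℕ) :
    |(-1 : ℝ) ^ q / (Nat.factorial q * Nat.factorial (q + n))| ≤ 1 / Nat.factorial q := by
  have h1 : (0:ℝ) < Nat.factorial q := by positivity
  have h2 : (1:ℝ) ≤ Nat.factorial (q + n) := by exact_mod_cast Nat.factorial_pos (q + n)
  rw [abs_div, abs_pow, abs_neg, abs_one, one_pow, abs_of_pos (by positivity)]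
  apply one_div_le_one_div_of_le h1
  nlinarith

lemma gterm_summable (n : ℕ) (y : ℝ) : Summable (fun q => gterm n q y) := by
  refine Summable.of_norm_bounded (g := fun q => |y| ^ q / Nat.factorial q)
    (Real.summable_pow_div_factorial |y|) ?_
  intro q
  rw [gterm, Real.norm_eq_abs, abs_mul, abs_pow]
  have := mul_le_mul_of_nonneg_right (gterm_coeff_bound n q) (pow_nonneg (abs_nonneg y) q)
  calc _ ≤ _ := this
    _ = _ := by ring

lemma gterm_deriv_succ (n q : ℕ) (y : ℝ) :
    (-1 : ℝ) ^ (q + 1) / (Nat.factorial (q + 1) * Nat.factorial (q + 1 + n))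
      * (((q + 1 : ℕ) : ℝ) * y ^ q) = - gterm (n + 1) q y := by
  rw [gterm, show q + (n + 1) = q + 1 + n by ring, Nat.factorial_succ q]
  have h1 : (Nat.factorial q : ℝ) ≠ 0 := by positivity
  have h2 : (Nat.factorial (q + 1 + n) : ℝ) ≠ 0 := by positivity
  have h3 : ((q : ℝ) + 1) ≠ 0 := by positivity
  push_cast
  field_simp
  ring

lemma gfun_hasDerivAt (n : ℕ) (y : ℝ) : HasDerivAt (gfun n) (-(gfun (n + 1) y)) y := by
  set R := |y| + 1 with hR
  have hRpos : 0 < R := by positivity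
  let d : ℕ → ℝ → ℝ := fun q z =>
    (-1 : ℝ) ^ q / (Nat.factorial q * Nat.factorial (q + n)) * ((q : ℝ) * z ^ (q - 1))
  have hu : Summable (fun q : ℕ => 1 / (Nat.factorial q : ℝ) * ((q : ℝ) * R ^ (q - 1))) := by
    rw [← summable_nat_add_iff 1]
    refine (Real.summable_pow_div_factorial R).congr ?_
    intro q
    rw [Nat.factorial_succ, Nat.add_sub_cancel]
    have h1 : (Nat.factorial q : ℝ) ≠ 0 := by positivity
    have h3 : ((q : ℝ) + 1) ≠ 0 := by positivity
    push_cast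
    field_simp
  have hy : y ∈ Metric.ball (0:ℝ) R := by
    simp [hR]
  have key := hasDerivAt_tsum_of_isPreconnected (g := fun q z => gterm n q z) (g' := d)
    (y := y) hu Metric.isOpen_ball
    (convex_ball (0:ℝ) R).isPreconnected
    (fun q z _ => by
      exact (hasDerivAt_pow q z).const_mul _)
    (fun q z hz => by
      have hz' : |z| ≤ R := by
        have := mem_ball_zero_iff.1 hz
        rw [Real.norm_eq_abs] at this
        exact this.le
      simp only [d]
      rw [Real.norm_eq_abs, abs_mul, abs_mul, abs_pow z, Nat.abs_cast]
      gcongr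
      exact gterm_coeff_bound n q)
    hy (gterm_summable n y) hy
  have hd : (∑' q, d q y) = -(gfun (n + 1) y) := by
    have hs : HasSum (fun q => d (q + 1) y) (-(gfun (n + 1) y)) := by
      have := (gterm_summable (n + 1) y).hasSum.neg
      refine this.congr_fun ?_ 
      intro q
      exact gterm_deriv_succ n q y
    have := (hasSum_nat_add_iff (f := fun q => d q y) 1).1 hs
    rw [this.tsum_eq]
    simp [d]
  rw [hd] at key
  exact key

lemma gfun_rec (n : ℕ) (y : ℝ) :
    y * gfun (n + 2) y - (n + 1) * gfun (n + 1) y + gfun n y = 0 := by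
  have hA : HasSum (fun q => (gterm n q y - (n + 1) * gterm (n + 1) q y))
      (gfun n y - (n + 1) * gfun (n + 1) y) :=
    (gterm_summable n y).hasSum.sub ((gterm_summable (n + 1) y).hasSum.mul_left _)
  have hB : HasSum (fun q => -(y * gterm (n + 2) q y)) (-(y * gfun (n + 2) y)) :=
    ((gterm_summable (n + 2) y).hasSum.mul_left y).neg
  have hC := (hasSum_nat_add_iff' 1).2 hA
  have h0 : gterm n 0 y - (n + 1) * gterm (n + 1) 0 y = 0 := by
    simp only [gterm, zero_add, Nat.factorial_succ n]
    have h1 : (Nat.factorial n : ℝ) ≠ 0 := by positivity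
    have h3 : ((n : ℝ) + 1) ≠ 0 := by positivity
    push_cast
    field_simp
    simp
  have hfun : (fun q => (gterm n (q + 1) y - (n + 1) * gterm (n + 1) (q + 1) y))
      = fun q => -(y * gterm (n + 2) q y) := by
    funext q
    simp only [gterm]
    rw [show q + 1 + (n + 1) = q + 1 + n + 1 by ring, show q + (n + 2) = q + 1 + n + 1 by ring,
      Nat.factorial_succ q, Nat.factorial_succ (q + 1 + n)]
    have h1 : (Nat.factorial q : ℝ) ≠ 0 := by positivity
    have h2 : (Nat.factorial (q + 1 + n) : ℝ) ≠ 0 := by positivity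
    have h3 : ((q : ℝ) + 1) ≠ 0 := by positivity
    have h4 : ((q : ℝ) + 1 + n + 1) ≠ 0 := by positivity
    push_cast
    field_simp
    ring
  rw [hfun, Finset.sum_range_one, h0] at hC
  have := hC.unique hB
  linarith

lemma besselJ_eq (n : ℕ) (x : ℝ) : besselJ n x = (x / 2) ^ n * gfun n ((x / 2) ^ 2) := by
  rw [besselJ, gfun, ← tsum_mul_left]
  congr 1
  funext q
  rw [gterm, pow_add, pow_mul]
  ring

lemma scaled_hasDerivAt (n : ℕ) (k r : ℝ) :
    HasDerivAt (fun r => gfun n ((k * r / 2) ^ 2))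
      (-(gfun (n + 1) ((k * r / 2) ^ 2)) * (k ^ 2 * r / 2)) r := by
  have h1 : HasDerivAt (fun r : ℝ => (k * r / 2) ^ 2) (k ^ 2 * r / 2) r := by
    have := ((((hasDerivAt_id r).const_mul k).div_const 2).pow 2)
    refine this.congr_deriv ?_
    simp
    ring
  exact (gfun_hasDerivAt n _).comp r h1

lemma scaled_pow_hasDerivAt (m : ℕ) (k r : ℝ) :
    HasDerivAt (fun r : ℝ => (k * r / 2) ^ m) (m * (k * r / 2) ^ (m - 1) * (k / 2)) r := by
  have := ((((hasDerivAt_id r).const_mul k).div_const 2).pow m)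
  refine this.congr_deriv ?_
  simp

/-- For `h(r) := Jₙ(k·r)`, the parametric Bessel equation holds:
`r² h''(r) + r h'(r) + (k² r² − n²) h(r) = 0` for all real `r`. -/
theorem besselJ_scaled_satisfies_parametric_bessel_equation (n : ℕ) (k : ℝ)
    (h : ℝ → ℝ) (hh : ∀ r, h r = besselJ n (k * r)) (r : ℝ) :
    r ^ 2 * deriv (deriv h) r + r * deriv h r
      + (k ^ 2 * r ^ 2 - (n : ℝ) ^ 2) * h r = 0 := by
  have hf : h = fun r => (k * r / 2) ^ n * gfun n ((k * r / 2) ^ 2) := by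
    funext r
    rw [hh, besselJ_eq]
  have hd : deriv h = fun r => (n * (k * r / 2) ^ (n - 1) * (k / 2)) * gfun n ((k * r / 2) ^ 2)
      + (k * r / 2) ^ n * (-(gfun (n + 1) ((k * r / 2) ^ 2)) * (k ^ 2 * r / 2)) := by
    funext r
    rw [hf]
    exact ((scaled_pow_hasDerivAt n k r).mul (scaled_hasDerivAt n k r)).deriv
  have hlin : HasDerivAt (fun r : ℝ => k ^ 2 * r / 2) (k ^ 2 / 2) r := by
    simpa using ((hasDerivAt_id r).const_mul (k ^ 2)).div_const 2
  have hdd := ((((scaled_pow_hasDerivAt (n - 1) k r).const_mul (n : ℝ)).mul_const (k / 2)).mul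
    (scaled_hasDerivAt n k r)).add ((scaled_pow_hasDerivAt n k r).mul
      ((scaled_hasDerivAt (n + 1) k r).neg.mul hlin))
  have hdd' := (hdd.congr_of_eventuallyEq (f₁ := deriv h)
    (Filter.EventuallyEq.of_eq (by rw [hd]; rfl))).deriv
  rw [hdd', hd, hf]
  have hrec := gfun_rec n ((k * r / 2) ^ 2)
  have hg : gfun n ((k * r / 2) ^ 2) = (n + 1) * gfun (n + 1) ((k * r / 2) ^ 2)
      - (k * r / 2) ^ 2 * gfun (n + 2) ((k * r / 2) ^ 2) := by linarith
  simp only [Pi.neg_apply, Pi.mul_apply]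
  rw [show n + 1 + 1 = n + 2 by ring]
  generalize gfun (n + 2) ((k * r / 2) ^ 2) = C at *
  generalize gfun (n + 1) ((k * r / 2) ^ 2) = B at *
  generalize gfun n ((k * r / 2) ^ 2) = A at *
  subst hg
  clear hrec hdd hdd' hd hf hlin
  rcases n with _ | _ | m
  · simp
    ring
  · simp
    ring
  · simp only [Nat.add_sub_cancel, show m + 1 + 1 - 1 = m + 1 by omega]
    push_cast
    ring
end

section
/- Let D, d : ℝ → ℝ be continuous and let s, k be real numbers. Define V(t,r) := J_0(k·r) · exp(−∫_0^{t−s} (k²·D(γ) + d(γ)) dγ). Then for all t and all r > 0, V satisfies the radially symmetric linear reaction–diffusion equation ∂V/∂t = D(t−s)·(∂²V/∂r² + (1/r)·∂V/∂r) − d(t−s)·V. -/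
open MeasureTheory

theorem aux_summable (a : ℕ → ℝ) (ha : ∀ q, |a q| ≤ 1 / (Nat.factorial q : ℝ)) (y : ℝ) :
    Summable (fun q => a q * y ^ q) := by
  refine Summable.of_norm_bounded (Real.summable_pow_div_factorial |y|) (fun q => ?_)
  rw [Real.norm_eq_abs, abs_mul, abs_pow]
  calc |a q| * |y| ^ q ≤ 1 / (Nat.factorial q : ℝ) * |y| ^ q := by gcongr; exact ha q
    _ = _ := by ring

theorem aux_shift (a : ℕ → ℝ) (ha : ∀ q, |a q| ≤ 1 / (Nat.factorial q : ℝ)) (q : ℕ) :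
    |((q : ℝ) + 1) * a (q + 1)| ≤ 1 / (Nat.factorial q : ℝ) := by
  have h := ha (q + 1)
  rw [abs_mul, abs_of_pos (by positivity : (0 : ℝ) < (q : ℝ) + 1)]
  have hq : (0 : ℝ) < Nat.factorial q := by positivity
  calc ((q : ℝ) + 1) * |a (q + 1)| ≤ ((q : ℝ) + 1) * (1 / (Nat.factorial (q + 1) : ℝ)) := by
        gcongr
    _ = _ := by rw [Nat.factorial_succ]; push_cast; field_simp

theorem aux_deriv (a : ℕ → ℝ) (ha : ∀ q, |a q| ≤ 1 / (Nat.factorial q : ℝ)) (y : ℝ) :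
    HasDerivAt (fun z => ∑' q, a q * z ^ q) (∑' q : ℕ, (((q : ℝ) + 1) * a (q + 1)) * y ^ q) y := by
  set R : ℝ := |y| + 1 with hR
  have hR0 : 0 < R := by positivity
  have hu : Summable (fun q : ℕ => |a q| * ((q : ℝ) * R ^ (q - 1))) := by
    rw [← summable_nat_add_iff 1]
    have h := (aux_summable _ (aux_shift a ha) R).abs
    refine h.congr (fun q => ?_)
    rw [abs_mul, abs_mul, abs_of_pos (by positivity : (0 : ℝ) < (q : ℝ) + 1),
      abs_of_pos (by positivity : (0 : ℝ) < R ^ q)]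
    push_cast
    try simp only [Nat.add_sub_cancel]
    ring
  have hy : y ∈ Metric.ball (0 : ℝ) R := by simp [hR]
  have key := hasDerivAt_tsum_of_isPreconnected (g := fun q z => a q * z ^ q)
    (g' := fun q z => a q * ((q : ℝ) * z ^ (q - 1))) (t := Metric.ball (0 : ℝ) R) (y₀ := y)
    hu Metric.isOpen_ball (convex_ball (0 : ℝ) R).isPreconnected
    (fun q z _ => (hasDerivAt_pow q z).const_mul (a q))
    (fun q z hz => by
      have hz' : |z| ≤ R := by
        have := Metric.mem_ball.1 hz
        rw [Real.dist_eq, sub_zero] at this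
        exact this.le
      rw [Real.norm_eq_abs, abs_mul, abs_mul, abs_pow, Nat.abs_cast]
      gcongr)
    hy (aux_summable a ha y) hy
  have hs : Summable (fun q : ℕ => a q * ((q : ℝ) * y ^ (q - 1))) := by
    rw [← summable_nat_add_iff 1]
    refine (aux_summable _ (aux_shift a ha) y).congr (fun q => ?_)
    push_cast
    try simp only [Nat.add_sub_cancel]
    ring
  refine key.congr_deriv ?_
  rw [hs.tsum_eq_zero_add]
  simp only [Nat.cast_zero, zero_mul, mul_zero, zero_add]
  refine tsum_congr (fun q => ?_)
  push_cast
  try simp only [Nat.add_sub_cancel]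
  ring

theorem aux_bessel : ∃ F F1 F2 : ℝ → ℝ, (∀ x, besselJ 0 x = F ((x / 2) ^ 2)) ∧
    (∀ y, HasDerivAt F (F1 y) y) ∧ (∀ y, HasDerivAt F1 (F2 y) y) ∧
    ∀ y, y * F2 y + F1 y = - F y := by
  set c : ℕ → ℝ := fun q => (-1 : ℝ) ^ q / (Nat.factorial q * Nat.factorial q) with hc
  have h0 : ∀ q, |c q| ≤ 1 / (Nat.factorial q : ℝ) := by
    intro q
    have h1 : (1 : ℝ) ≤ Nat.factorial q := by exact_mod_cast Nat.factorial_pos q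
    simp only [hc, abs_div, abs_pow, abs_neg, abs_one, one_pow, abs_mul, Nat.abs_cast]
    gcongr
    nlinarith
  have h1 := aux_shift c h0
  have h2 := aux_shift _ h1
  refine ⟨_, _, _, fun x => ?_, fun y => aux_deriv c h0 y, fun y => aux_deriv _ h1 y, fun y => ?_⟩
  · unfold besselJ
    refine tsum_congr (fun q => ?_)
    simp only [hc, add_zero, pow_mul]
  · have s0 := aux_summable c h0 y
    have s1 := aux_summable _ h1 y
    have s2 := (aux_summable _ h2 y).mul_left y
    have s2' : Summable (fun q : ℕ => (q : ℝ) * (((q : ℝ) + 1) * c (q + 1)) * y ^ q) := by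
      rw [← summable_nat_add_iff 1]
      refine s2.congr (fun q => ?_)
      push_cast
      ring
    have e : y * ∑' q : ℕ, (((q : ℝ) + 1) * (((q + 1 : ℕ) : ℝ) + 1) * c (q + 1 + 1)) * y ^ q
        = ∑' q : ℕ, (q : ℝ) * (((q : ℝ) + 1) * c (q + 1)) * y ^ q := by
      rw [s2'.tsum_eq_zero_add, ← tsum_mul_left]
      simp only [Nat.cast_zero, zero_mul, zero_add]
      refine tsum_congr (fun q => ?_)
      push_cast
      ring
    simp only [mul_assoc] at e s1 s2' ⊢
    rw [e, ← s2'.tsum_add s1, ← tsum_neg]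
    refine tsum_congr (fun q => ?_)
    have hq : (0 : ℝ) < Nat.factorial q := by positivity
    simp only [hc, Nat.factorial_succ]
    push_cast
    field_simp
    ring

/-- `V(t,r) := J₀(k·r)·exp(−∫_0^{t−s} (k²·D(γ)+d(γ)) dγ)` satisfies the radially symmetric
linear reaction–diffusion equation `∂V/∂t = D(t−s)·(V_rr + (1/r)·V_r) − d(t−s)·V`
for all `t` and all `r > 0`. -/
theorem radial_mode_solves_radial_RD (D d : ℝ → ℝ) (hD : Continuous D)
    (hd : Continuous d) (s k : ℝ) (V : ℝ → ℝ → ℝ)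
    (hV : ∀ t r, V t r =
      besselJ 0 (k * r) * Real.exp (-∫ γ in (0 : ℝ)..(t - s), (k ^ 2 * D γ + d γ))) :
    ∀ (t r : ℝ), 0 < r →
      deriv (fun t' => V t' r) t =
        D (t - s) * (deriv (deriv (fun r' => V t r')) r
          + (1 / r) * deriv (fun r' => V t r') r)
        - d (t - s) * V t r := by
  intro t r hr
  obtain ⟨F, F1, F2, hF, hF1, hF2, hode⟩ := aux_bessel
  have hy : ∀ x : ℝ, HasDerivAt (fun r' : ℝ => (k * r' / 2) ^ 2) (k ^ 2 * x / 2) x := by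
    intro x
    have h := ((((hasDerivAt_id' x).const_mul k).div_const 2).fun_pow 2)
    refine h.congr_deriv ?_
    simp
    ring
  have hVr : (fun r' => V t r') = fun r' => F ((k * r' / 2) ^ 2) *
      Real.exp (-∫ γ in (0 : ℝ)..(t - s), (k ^ 2 * D γ + d γ)) := by
    funext r'
    rw [hV, hF]
  have hVt : (fun t' => V t' r) = fun t' => besselJ 0 (k * r) *
      Real.exp (-∫ γ in (0 : ℝ)..(t' - s), (k ^ 2 * D γ + d γ)) := by
    funext t'
    rw [hV]
  have hcont : Continuous (fun γ => k ^ 2 * D γ + d γ) := by fun_prop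
  have hI : HasDerivAt (fun u => ∫ γ in (0 : ℝ)..u, (k ^ 2 * D γ + d γ))
      (k ^ 2 * D (t - s) + d (t - s)) (t - s) :=
    intervalIntegral.integral_hasDerivAt_right (hcont.intervalIntegrable _ _)
      (hcont.stronglyMeasurableAtFilter _ _) hcont.continuousAt
  have hI' := (((hI.comp_sub_const t s).fun_neg).exp).const_mul (besselJ 0 (k * r))
  rw [hVt, hI'.deriv, hVr, hV, hF]
  generalize Real.exp (-∫ γ in (0 : ℝ)..(t - s), (k ^ 2 * D γ + d γ)) = E
  have d1 : ∀ x, HasDerivAt (fun r' => F ((k * r' / 2) ^ 2) * E)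
      (F1 ((k * x / 2) ^ 2) * (k ^ 2 * x / 2) * E) x := fun x =>
    ((hF1 _).comp x (hy x)).mul_const E
  have d1' : deriv (fun r' => F ((k * r' / 2) ^ 2) * E) =
      fun x => F1 ((k * x / 2) ^ 2) * (k ^ 2 * x / 2) * E := funext fun x => (d1 x).deriv
  have hlin : HasDerivAt (fun x : ℝ => k ^ 2 * x / 2) (k ^ 2 / 2) r := by
    simpa using ((hasDerivAt_id' r).const_mul (k ^ 2)).div_const 2
  have d2 : HasDerivAt (fun x => F1 ((k * x / 2) ^ 2) * (k ^ 2 * x / 2) * E)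
      ((F2 ((k * r / 2) ^ 2) * (k ^ 2 * r / 2) * (k ^ 2 * r / 2)
        + F1 ((k * r / 2) ^ 2) * (k ^ 2 / 2)) * E) r :=
    (((hF2 _).comp r (hy r)).mul hlin).mul_const E
  rw [d1', d2.deriv]
  have ho := hode ((k * r / 2) ^ 2)
  have hr' : r ≠ 0 := hr.ne'
  have e1 : 1 / r * (F1 ((k * r / 2) ^ 2) * (k ^ 2 * r / 2) * E) =
      F1 ((k * r / 2) ^ 2) * (k ^ 2 / 2) * E := by field_simp
  simp only [e1]
  linear_combination (-(D (t - s)) * k ^ 2 * E) * ho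
end

section
/- Let D, d : ℝ → ℝ be continuous, let s be real, let I be a finite index set, and for each j ∈ I let k_j and c_j be real numbers. Define V(t,r) := Σ_{j∈I} c_j · J_0(k_j·r) · exp(−∫_0^{t−s} (k_j²·D(γ) + d(γ)) dγ). Then for all t and all r > 0, V satisfies the radially symmetric linear reaction–diffusion equation ∂V/∂t = D(t−s)·(∂²V/∂r² + (1/r)·∂V/∂r) − d(t−s)·V. -/
open MeasureTheory

/-- Bessel–Clifford function. -/
noncomputable def bcF (m : ℕ) (y : ℝ) : ℝ :=
  ∑' q : ℕ, y ^ q / (Nat.factorial q * Nat.factorial (q + m))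

lemma bcF_bound (m q : ℕ) (y R : ℝ) (h : |y| ≤ R) :
    ‖y ^ q / ((Nat.factorial q : ℝ) * Nat.factorial (q + m))‖ ≤ R ^ q / Nat.factorial q := by
  have h1 : (1 : ℝ) ≤ Nat.factorial (q + m) := by exact_mod_cast Nat.factorial_pos (q + m)
  have h2 : (1 : ℝ) ≤ Nat.factorial q := by exact_mod_cast Nat.factorial_pos q
  have hR : 0 ≤ R := (abs_nonneg y).trans h
  rw [norm_div, norm_pow, Real.norm_eq_abs]
  have h3 : ‖(Nat.factorial q : ℝ) * Nat.factorial (q + m)‖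
      = (Nat.factorial q : ℝ) * Nat.factorial (q + m) := by
    rw [Real.norm_eq_abs, abs_of_nonneg (by positivity)]
  rw [h3]
  apply div_le_div₀ (by positivity) (pow_le_pow_left₀ (abs_nonneg y) h q) (by linarith)
  nlinarith

lemma bcF_summable (m : ℕ) (y : ℝ) :
    Summable fun q : ℕ => y ^ q / ((Nat.factorial q : ℝ) * Nat.factorial (q + m)) :=
  Summable.of_norm_bounded (Real.summable_pow_div_factorial |y|)
    fun q => bcF_bound m q y _ le_rfl

lemma bcF_term_succ (m q : ℕ) (y : ℝ) :
    ((q + 1 : ℕ) : ℝ) * y ^ (q + 1 - 1) / (Nat.factorial (q + 1) * Nat.factorial (q + 1 + m))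
      = y ^ q / ((Nat.factorial q : ℝ) * Nat.factorial (q + (m + 1))) := by
  have h1 : (Nat.factorial (q + (m + 1)) : ℝ) ≠ 0 := by exact_mod_cast Nat.factorial_ne_zero _
  have h2 : (Nat.factorial q : ℝ) ≠ 0 := by exact_mod_cast Nat.factorial_ne_zero _
  have h3 : ((q : ℝ) + 1) ≠ 0 := by positivity
  rw [show q + 1 + m = q + (m + 1) by ring, Nat.factorial_succ q]
  simp only [Nat.add_sub_cancel]
  push_cast
  field_simp

lemma bcF_hasDerivAt (m : ℕ) (y : ℝ) : HasDerivAt (bcF m) (bcF (m + 1) y) y := by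
  set R := |y| + 1 with hR
  have key := hasDerivAt_tsum_of_isPreconnected
    (u := fun q : ℕ => if q = 0 then 0 else R ^ (q - 1) / Nat.factorial (q - 1))
    (g := fun (q : ℕ) (z : ℝ) => z ^ q / ((Nat.factorial q : ℝ) * Nat.factorial (q + m)))
    (g' := fun (q : ℕ) (z : ℝ) => (q : ℝ) * z ^ (q - 1) /
      ((Nat.factorial q : ℝ) * Nat.factorial (q + m)))
    (t := Metric.ball 0 R) (y₀ := y) (y := y) ?_ Metric.isOpen_ball
    (convex_ball _ _).isPreconnected ?_ ?_ ?_ (bcF_summable m y) ?_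
  · have h2 : ∑' q : ℕ, (q : ℝ) * y ^ (q - 1) / ((Nat.factorial q : ℝ) * Nat.factorial (q + m))
        = bcF (m + 1) y := by
      rw [Summable.tsum_eq_zero_add]
      · rw [bcF, tsum_congr (fun q => bcF_term_succ m q y)]
        simp
      · rw [← summable_nat_add_iff 1]
        exact (bcF_summable (m + 1) y).congr fun q => (bcF_term_succ m q y).symm
    rw [← h2]
    exact key
  · rw [← summable_nat_add_iff 1]
    simpa using Real.summable_pow_div_factorial R
  · intro q z _
    exact (hasDerivAt_pow q z).div_const _
  · intro q z hz
    rcases q with _ | q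
    · simp
    · rw [bcF_term_succ]
      have : |z| ≤ R := by simpa using (Metric.mem_ball.1 hz).le
      simpa using bcF_bound (m + 1) q z R this
  · simp [hR]
  · simp [hR]

lemma bcF_rec (y : ℝ) : bcF 1 y + y * bcF 2 y = bcF 0 y := by
  have e : ∀ q : ℕ, (q + 1 : ℕ) * y ^ (q + 1) / ((Nat.factorial (q + 1) : ℝ) *
      Nat.factorial (q + 1 + 1)) = y * (y ^ q / ((Nat.factorial q : ℝ) *
      Nat.factorial (q + 2))) := by
    intro q
    have := bcF_term_succ 1 q y
    rw [show q + 2 = q + (1 + 1) by ring, ← this]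
    simp only [Nat.add_sub_cancel]
    ring
  have hs : Summable fun q : ℕ => (q : ℝ) * y ^ q / ((Nat.factorial q : ℝ) *
      Nat.factorial (q + 1)) := by
    rw [← summable_nat_add_iff 1]
    exact ((bcF_summable 2 y).mul_left y).congr fun q => (e q).symm
  have h2 : y * bcF 2 y = ∑' q : ℕ, (q : ℝ) * y ^ q / ((Nat.factorial q : ℝ) *
      Nat.factorial (q + 1)) := by
    rw [hs.tsum_eq_zero_add, tsum_congr e, tsum_mul_left, bcF]
    simp
  rw [h2, bcF, ← (bcF_summable 1 y).tsum_add hs, bcF]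
  refine tsum_congr fun q => ?_
  have h2 : (Nat.factorial q : ℝ) ≠ 0 := by exact_mod_cast Nat.factorial_ne_zero _
  have h3 : ((q : ℝ) + 1) ≠ 0 := by positivity
  rw [Nat.factorial_succ q, add_zero]
  push_cast
  field_simp
  ring

lemma besselJ_zero_eq (x : ℝ) : besselJ 0 x = bcF 0 (-(x ^ 2 / 4)) := by
  rw [besselJ, bcF]
  refine tsum_congr fun q => ?_
  rw [add_zero, add_zero, pow_mul, show -(x ^ 2 / 4) = (-1) * (x / 2) ^ 2 by ring, mul_pow]
  ring

lemma inner_hasDerivAt (a r : ℝ) :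
    HasDerivAt (fun r : ℝ => -((a * r) ^ 2 / 4)) (-(a ^ 2 * r / 2)) r := by
  have := ((((hasDerivAt_id r).const_mul a).pow 2).div_const 4).neg
  refine this.congr_deriv ?_
  simp only [id]
  push_cast
  ring

lemma bessel_d1 (a r : ℝ) : HasDerivAt (fun r => besselJ 0 (a * r))
    (-(a ^ 2 * r / 2) * bcF 1 (-((a * r) ^ 2 / 4))) r := by
  simp only [besselJ_zero_eq]
  have := (bcF_hasDerivAt 0 _).comp r (inner_hasDerivAt a r)
  rw [mul_comm]
  exact this

lemma bessel_d2 (a r : ℝ) :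
    HasDerivAt (fun r => -(a ^ 2 * r / 2) * bcF 1 (-((a * r) ^ 2 / 4)))
    (-(a ^ 2 / 2) * bcF 1 (-((a * r) ^ 2 / 4)) +
      -(a ^ 2 * r / 2) * (bcF 2 (-((a * r) ^ 2 / 4)) * (-(a ^ 2 * r / 2)))) r := by
  have h1 := (bcF_hasDerivAt 1 _).comp r (inner_hasDerivAt a r)
  have h0 : HasDerivAt (fun r : ℝ => -(a ^ 2 * r / 2)) (-(a ^ 2 / 2)) r := by
    refine (((hasDerivAt_id r).const_mul (a ^ 2)).div_const 2).neg.congr_deriv ?_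
    ring
  exact h0.mul h1

/-- A finite superposition
`V(t,r) := Σ_{j∈I} c_j·J₀(k_j·r)·exp(−∫_0^{t−s} (k_j²·D(γ)+d(γ)) dγ)` satisfies the
radially symmetric linear reaction–diffusion equation for all `t` and all `r > 0`. -/
theorem radial_superposition_solves_radial_RD {ι : Type*} (I : Finset ι)
    (D d : ℝ → ℝ) (hD : Continuous D) (hd : Continuous d) (s : ℝ)
    (k c : ι → ℝ) (V : ℝ → ℝ → ℝ)
    (hV : ∀ t r, V t r = ∑ j ∈ I, c j * besselJ 0 (k j * r) *
      Real.exp (-∫ γ in (0 : ℝ)..(t - s), ((k j) ^ 2 * D γ + d γ))) :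
    ∀ (t r : ℝ), 0 < r →
      deriv (fun t' => V t' r) t =
        D (t - s) * (deriv (deriv (fun r' => V t r')) r
          + (1 / r) * deriv (fun r' => V t r') r)
        - d (t - s) * V t r := by
  intro t r hr
  set E : ι → ℝ → ℝ := fun j t =>
    Real.exp (-∫ γ in (0 : ℝ)..(t - s), ((k j) ^ 2 * D γ + d γ)) with hE
  have hEd : ∀ j, HasDerivAt (E j) (E j t * -((k j) ^ 2 * D (t - s) + d (t - s))) t := by
    intro j
    have hc : Continuous fun γ => (k j) ^ 2 * D γ + d γ := by fun_prop
    have h1 := (hc.integral_hasStrictDerivAt 0 (t - s)).hasDerivAt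
    have h2 : HasDerivAt (fun t : ℝ => t - s) 1 t := (hasDerivAt_id t).sub_const s
    have h3 := (h1.comp t h2).neg.exp
    simpa using h3
  have hVt : HasDerivAt (fun t' => V t' r) (∑ j ∈ I, c j * besselJ 0 (k j * r) *
      (E j t * -((k j) ^ 2 * D (t - s) + d (t - s)))) t := by
    rw [show (fun t' => V t' r) = fun t' => ∑ j ∈ I, c j * besselJ 0 (k j * r) * E j t' from
      funext fun t' => hV t' r]
    exact HasDerivAt.fun_sum fun j _ => (hEd j).const_mul _
  have hVr : ∀ r, HasDerivAt (fun r' => V t r') (∑ j ∈ I, c j *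
      (-((k j) ^ 2 * r / 2) * bcF 1 (-((k j * r) ^ 2 / 4))) * E j t) r := by
    intro r
    rw [show (fun r' => V t r') = fun r' => ∑ j ∈ I, c j * besselJ 0 (k j * r') * E j t from
      funext fun r' => hV t r']
    exact HasDerivAt.fun_sum fun j _ => ((bessel_d1 (k j) r).const_mul _).mul_const _
  have hVrr := HasDerivAt.fun_sum (u := I) fun j _ =>
    ((bessel_d2 (k j) r).const_mul (c j)).mul_const (E j t)
  rw [hVt.deriv, funext fun r => (hVr r).deriv, hVrr.deriv, hV t r]
  simp only []
  rw [Finset.mul_sum, ← Finset.sum_add_distrib, Finset.mul_sum, Finset.mul_sum,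
    ← Finset.sum_sub_distrib]
  refine Finset.sum_congr rfl fun j _ => ?_
  have hrec := bcF_rec (-((k j * r) ^ 2 / 4))
  change _ = _ - d (t - s) * (_ * E j t)
  rw [besselJ_zero_eq, ← hrec]
  field_simp
  ring
end

section
/- Let n be a natural number, R > 0, and let a, b be positive real numbers with a ≠ b such that J_n'(a·R) = 0 and J_n'(b·R) = 0 (zero-flux boundary condition). Then ∫_0^R r · J_n(a·r) · J_n(b·r) dr = 0. -/
open MeasureTheory

namespace BesselAux

/-- Coefficients whose generating series is entire. -/
def Ent (d : ℕ → ℝ) : Prop := ∀ M : ℝ, 0 ≤ M → Summable fun q => |d q| * M ^ q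

/-- The series with step two, starting at the exponent `n`. -/
noncomputable def S (n : ℕ) (d : ℕ → ℝ) (x : ℝ) : ℝ := ∑' q : ℕ, d q * x ^ (2 * q + n)

lemma Ent.mul {n : ℕ} {d : ℕ → ℝ} (h : Ent d) : Ent fun q => d q * ((2 * q + n : ℕ) : ℝ) := by
  intro M hM
  refine Summable.of_nonneg_of_le (fun q => by positivity) (fun q => ?_)
    ((h (4 * M) (by positivity)).mul_left ((2 : ℝ) ^ n))
  have h1 : ((2 * q + n : ℕ) : ℝ) ≤ 2 ^ (2 * q + n) := by
    exact_mod_cast (Nat.lt_two_pow_self (n := 2 * q + n)).le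
  have h2 : (2 : ℝ) ^ (2 * q + n) = 2 ^ n * 4 ^ q := by
    rw [pow_add, pow_mul]; norm_num [mul_comm]
  rw [abs_mul, abs_of_nonneg (Nat.cast_nonneg (α := ℝ) _), mul_pow]
  rw [h2] at h1
  calc _ = (|d q| * M ^ q) * ((2 * q + n : ℕ) : ℝ) := by ring
    _ ≤ (|d q| * M ^ q) * (2 ^ n * 4 ^ q) := by gcongr
    _ = _ := by ring

lemma Ent.summable {d : ℕ → ℝ} (h : Ent d) (n : ℕ) (x : ℝ) :
    Summable fun q => |d q| * |x| ^ (2 * q + n) := by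
  refine ((h (|x| ^ 2) (by positivity)).mul_left (|x| ^ n)).congr (fun q => ?_)
  rw [pow_add, pow_mul]; ring

lemma Ent.summable' {d : ℕ → ℝ} (h : Ent d) (n : ℕ) (x : ℝ) :
    Summable fun q => d q * x ^ (2 * q + n) := by
  refine Summable.of_norm ((h.summable n x).congr fun q => ?_)
  simp

lemma hasDerivAt_S {n : ℕ} {d : ℕ → ℝ} (h : Ent d) (x : ℝ) :
    HasDerivAt (S n d) (∑' q : ℕ, d q * (((2 * q + n : ℕ) : ℝ) * x ^ (2 * q + n - 1))) x := by
  have hx : x ∈ Metric.ball (0 : ℝ) (|x| + 1) := by simp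
  refine hasDerivAt_tsum_of_isPreconnected (t := Metric.ball (0 : ℝ) (|x| + 1))
    (u := fun q => |d q * ((2 * q + n : ℕ) : ℝ)| * |(|x| + 1)| ^ (2 * q + n))
    (g := fun q y => d q * y ^ (2 * q + n))
    (g' := fun q y => d q * (((2 * q + n : ℕ) : ℝ) * y ^ (2 * q + n - 1)))
    (Ent.summable h.mul n _) Metric.isOpen_ball (convex_ball _ _).isPreconnected
    (fun q y _ => (hasDerivAt_pow _ y).const_mul _) (fun q y hy => ?_) hx (h.summable' n x) hx
  have hy' : |y| ≤ |x| + 1 := by simpa using (Metric.mem_ball.1 hy).le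
  rw [← mul_assoc, norm_mul, Real.norm_eq_abs, Real.norm_eq_abs, abs_pow,
    abs_of_nonneg (by positivity : 0 ≤ |x| + 1)]
  gcongr
  calc |y| ^ (2 * q + n - 1) ≤ (|x| + 1) ^ (2 * q + n - 1) := by gcongr
    _ ≤ _ := pow_le_pow_right₀ (by linarith [abs_nonneg x]) (Nat.sub_le _ _)

lemma mul_deriv_S {n : ℕ} {d : ℕ → ℝ} (h : Ent d) (x : ℝ) :
    x * deriv (S n d) x = S n (fun q => d q * ((2 * q + n : ℕ) : ℝ)) x := by
  rw [(hasDerivAt_S h x).deriv, ← tsum_mul_left]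
  refine tsum_congr fun q => ?_
  rcases Nat.eq_zero_or_pos (2 * q + n) with h0 | h0
  · simp [h0]
  · obtain ⟨m, hm⟩ : ∃ m, 2 * q + n = m + 1 := ⟨2 * q + n - 1, by omega⟩
    beta_reduce
    generalize 2 * q + n = k at hm ⊢
    subst hm
    rw [Nat.add_sub_cancel]; ring

/-- The Bessel coefficients. -/
noncomputable def c (n q : ℕ) : ℝ :=
  (-1 : ℝ) ^ q / (Nat.factorial q * Nat.factorial (q + n)) / 2 ^ (2 * q + n)

lemma ent_c (n : ℕ) : Ent (c n) := by
  intro M hM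
  refine Summable.of_nonneg_of_le (fun q => by positivity) (fun q => ?_)
    (Real.summable_pow_div_factorial M)
  have h1 : |c n q| = 1 / (Nat.factorial q * Nat.factorial (q + n) * 2 ^ (2 * q + n)) := by
    simp only [c, abs_div, abs_mul, abs_pow, Nat.abs_cast, abs_neg, abs_one, one_pow, div_div]
    norm_num
  have h2 : (1 : ℝ) ≤ Nat.factorial (q + n) := by exact_mod_cast Nat.factorial_pos _
  have h3 : (1 : ℝ) ≤ 2 ^ (2 * q + n) := one_le_pow₀ (by norm_num)
  have h4 : (0 : ℝ) < Nat.factorial q := by exact_mod_cast Nat.factorial_pos _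
  rw [h1, one_div_mul_eq_div]
  gcongr
  rw [mul_assoc]
  exact le_mul_of_one_le_right h4.le (one_le_mul_of_one_le_of_one_le h2 h3)

lemma besselJ_eq_s10 (n : ℕ) : besselJ n = S n (c n) := by
  funext x
  refine tsum_congr fun q => ?_
  rw [c, div_pow]; ring

lemma c_succ (n q : ℕ) : c n (q + 1) * (4 * (q + 1) * (q + 1 + n)) = - c n q := by
  have h1 : (Nat.factorial q : ℝ) ≠ 0 := by exact_mod_cast Nat.factorial_ne_zero _
  have h2 : (Nat.factorial (q + n) : ℝ) ≠ 0 := by exact_mod_cast Nat.factorial_ne_zero _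
  have h3 : (q : ℝ) + 1 ≠ 0 := by positivity
  have h4 : (q : ℝ) + n + 1 ≠ 0 := by positivity
  have e : q + 1 + n = (q + n) + 1 := by ring
  have e' : 2 * (q + 1) + n = (2 * q + n) + 2 := by ring
  rw [c, c, e, e', Nat.factorial_succ, Nat.factorial_succ]
  push_cast
  rw [pow_add _ _ 2, pow_succ (-1 : ℝ) q]
  field_simp
  ring

/-- The Bessel equation. -/
lemma ode (n : ℕ) (x : ℝ) :
    S n (fun q => c n q * ((2 * q + n : ℕ) : ℝ) * ((2 * q + n : ℕ) : ℝ)) x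
      = ((n : ℝ) ^ 2 - x ^ 2) * S n (c n) x := by
  have hs := (ent_c n).summable' n x
  have hs2 := (Ent.mul (n := n) (Ent.mul (n := n) (ent_c n))).summable' n x
  have key : S n (fun q => c n q * ((2 * q + n : ℕ) : ℝ) * ((2 * q + n : ℕ) : ℝ)) x
      - (n : ℝ) ^ 2 * S n (c n) x = - x ^ 2 * S n (c n) x := by
    simp only [S]
    rw [← tsum_mul_left, ← tsum_mul_left, ← hs2.tsum_sub (hs.mul_left _),
      (hs2.sub (hs.mul_left _)).tsum_eq_zero_add]
    have h0 : ∀ A : ℝ, A = 0 → ∀ B C : ℝ, B = C → A + B = C := by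
      intro A hA B C h; rw [hA, h, zero_add]
    apply h0
    · push_cast; ring
    · refine tsum_congr fun q => ?_
      have := c_succ n q
      have e' : 2 * (q + 1) + n = (2 * q + n) + 2 := by ring
      rw [e', pow_add x _ 2]
      push_cast
      linear_combination (x ^ (2 * q + n) * x ^ 2) * this
  linear_combination key

end BesselAux

open BesselAux in
/-- Orthogonality of Bessel eigenfunctions under zero-flux (Neumann) boundary conditions:
if `Jₙ'(aR) = 0 = Jₙ'(bR)` with `a ≠ b` positive, then
`∫_0^R r·Jₙ(ar)·Jₙ(br) dr = 0`. -/
theorem besselJ_orthogonality_neumann (n : ℕ) (R a b : ℝ) (hR : 0 < R)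
    (ha : 0 < a) (hb : 0 < b) (hab : a ≠ b)
    (haR : deriv (besselJ n) (a * R) = 0) (hbR : deriv (besselJ n) (b * R) = 0) :
    ∫ r in (0 : ℝ)..R, r * besselJ n (a * r) * besselJ n (b * r) = 0 := by
  rw [besselJ_eq_s10] at haR hbR ⊢
  have hE := ent_c n
  have hE1 := Ent.mul (n := n) hE
  set J := S n (c n) with hJ
  set K := S n (fun q => c n q * ((2 * q + n : ℕ) : ℝ)) with hK
  have dJ : Differentiable ℝ J := fun x => (hasDerivAt_S hE x).differentiableAt
  have dK : Differentiable ℝ K := fun x => (hasDerivAt_S hE1 x).differentiableAt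
  have eJ : ∀ x, x * deriv J x = K x := fun x => mul_deriv_S hE x
  have eK : ∀ x, x * deriv K x = ((n : ℝ) ^ 2 - x ^ 2) * J x := fun x =>
    (mul_deriv_S hE1 x).trans (ode n x)
  have cJ := dJ.continuous
  have cK := dK.continuous
  have comp : ∀ (f : ℝ → ℝ), Differentiable ℝ f → ∀ t r : ℝ,
      HasDerivAt (fun r => f (t * r)) (deriv f (t * r) * t) r := by
    intro f hf t r
    have h1 : HasDerivAt (fun r : ℝ => t * r) t r := by
      simpa using (hasDerivAt_id r).const_mul t
    exact (hf (t * r)).hasDerivAt.comp r h1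
  have main := intervalIntegral.integral_eq_sub_of_hasDerivAt_of_le (a := 0) (b := R) hR.le
    (f := fun r => K (a * r) * J (b * r) - J (a * r) * K (b * r))
    (f' := fun r => (b ^ 2 - a ^ 2) * (r * J (a * r) * J (b * r)))
    (Continuous.continuousOn (by fun_prop))
    (fun r hr => by
      have h := ((comp K dK a r).mul (comp J dJ b r)).sub ((comp J dJ a r).mul (comp K dK b r))
      refine h.congr_deriv ?_
      have hr0 : r ≠ 0 := hr.1.ne'
      apply mul_left_cancel₀ hr0
      have e1 := eJ (a * r)
      have e2 := eJ (b * r)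
      have e3 := eK (a * r)
      have e4 := eK (b * r)
      linear_combination J (b * r) * e3 + K (a * r) * e2 - K (b * r) * e1 - J (a * r) * e4)
    (Continuous.intervalIntegrable (by fun_prop) _ _)
  rw [intervalIntegral.integral_const_mul] at main
  have k0 : K 0 = 0 := by rw [← eJ 0, zero_mul]
  have ka : K (a * R) = 0 := by rw [← eJ, haR, mul_zero]
  have kb : K (b * R) = 0 := by rw [← eJ, hbR, mul_zero]
  simp only [mul_zero, k0, ka, kb, zero_mul, sub_zero] at main
  refine (mul_eq_zero.1 main).resolve_left fun h => hab ?_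
  have : (b - a) * (b + a) = 0 := by linear_combination h
  rcases mul_eq_zero.1 this with h | h <;> linarith
end
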